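/- Let n ≥ 5. If [-,-] is a Lie bracket on μ₀ⁿ making (μ₀ⁿ, ·, [-,-]) a transposed 0-Poisson algebra, then [e₁, eᵢ] = 0 for all 3 ≤ i ≤ n. -/

import Mathlib

open Finset

/-- The null-filiform associative multiplication on `ℂⁿ = Fin n → ℂ`.
The basis vector `e_i` (1-based) corresponds to the coordinate `i - 1`, and
`e_i · e_j = e_{i+j}` if `i + j ≤ n`, and `0` otherwise. -/
noncomputable def nfMul (n : ℕ) (x y : Fin n → ℂ) : Fin n → ℂ :=
  fun k => ∑ i : Fin n, ∑ j : Fin n,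
    if (i : ℕ) + (j : ℕ) + 1 = (k : ℕ) then x i * y j else 0

/-- The 1-based basis vector `e i` of `ℂⁿ` (zero if `i` is out of range `1,…,n`). -/
noncomputable def nfE (n : ℕ) (i : ℕ) : Fin n → ℂ :=
  fun k => if (k : ℕ) + 1 = i then 1 else 0

/-- The coefficient of the basis vector `e i` (1-based) in `x`. -/
noncomputable def nfCoeff (n : ℕ) (x : Fin n → ℂ) (i : ℕ) : ℂ :=
  ∑ k : Fin n, if (k : ℕ) + 1 = i then x k else 0

/-- A Lie bracket (bilinear, alternating, satisfying the Jacobi identity)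
on a complex vector space. -/
structure LieBracketOn (L : Type*) [AddCommGroup L] [Module ℂ L] where
  br : L → L → L
  add_left : ∀ x y z, br (x + y) z = br x z + br y z
  smul_left : ∀ (c : ℂ) (x y : L), br (c • x) y = c • br x y
  add_right : ∀ x y z, br x (y + z) = br x y + br x z
  smul_right : ∀ (c : ℂ) (x y : L), br x (c • y) = c • br x y
  alt : ∀ x, br x x = 0
  jacobi : ∀ x y z, br (br x y) z + br (br y z) x + br (br z x) y = 0

/-- `(μ₀ⁿ, ·, [-,-])` is a transposed `δ`-Poisson algebra:
`δ • (z · [x,y]) = [z·x, y] + [x, z·y]`. -/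
noncomputable def IsTransposedPoisson (n : ℕ) (δ : ℂ) (B : LieBracketOn (Fin n → ℂ)) : Prop :=
  ∀ x y z, δ • nfMul n z (B.br x y) = B.br (nfMul n z x) y + B.br x (nfMul n z y)

/-- `(μ₀ⁿ, ·, [-,-])` is a `δ`-Poisson algebra:
`[x, y·z] = δ • ([x,y]·z + y·[x,z])`. -/
noncomputable def IsDeltaPoisson (n : ℕ) (δ : ℂ) (B : LieBracketOn (Fin n → ℂ)) : Prop :=
  ∀ x y z, B.br x (nfMul n y z) = δ • (nfMul n (B.br x y) z + nfMul n y (B.br x z))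

/-- The bracket of the transposed 0-Poisson algebra `TP₀(α₁,…,αₙ)` on `μ₀ⁿ`:
determined by `[e₁,e₂] = ∑_{t=1}^n αₜ eₜ` and `[eᵢ,eⱼ] = 0` for all other
pairs `i < j`. -/
noncomputable def brTP0 (n : ℕ) (α : ℕ → ℂ) (x y : Fin n → ℂ) : Fin n → ℂ :=
  (nfCoeff n x 1 * nfCoeff n y 2 - nfCoeff n x 2 * nfCoeff n y 1) •
    ∑ t ∈ Finset.Icc 1 n, α t • nfE n t

/-- The bracket of the transposed 1-Poisson algebra `TP₁(α₂,…,αₙ)` on `μ₀ⁿ`: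
determined by `[e₁,eᵢ] = ∑_{t=i}^n α_{t-i+2} eₜ` for `2 ≤ i ≤ n` and
`[eᵢ,eⱼ] = 0` for `2 ≤ i < j ≤ n`. -/
noncomputable def brTP1 (n : ℕ) (α : ℕ → ℂ) (x y : Fin n → ℂ) : Fin n → ℂ :=
  ∑ i ∈ Finset.Icc 2 n,
    (nfCoeff n x 1 * nfCoeff n y i - nfCoeff n x i * nfCoeff n y 1) •
      ∑ t ∈ Finset.Icc i n, α (t + 2 - i) • nfE n t

/-- The bracket of the transposed `δ`-Poisson algebra `TP_δ(a, b, c)`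
(`a = α_{n-2}`, `b = α_{n-1}`, `c = αₙ`) on `μ₀ⁿ`: determined by
`[e₁,e₂] = a e_{n-2} + b e_{n-1} + c eₙ`, `[e₁,e₃] = δ(a e_{n-1} + b eₙ)`,
`[e₂,e₃] = ((δ²-δ)/2) a eₙ`, `[e₁,e₄] = ((δ²+δ)/2) a eₙ`, and `[eᵢ,eⱼ] = 0`
for all other pairs `i < j`. -/
noncomputable def brTPd (n : ℕ) (δ a b c : ℂ) (x y : Fin n → ℂ) : Fin n → ℂ :=
  (nfCoeff n x 1 * nfCoeff n y 2 - nfCoeff n x 2 * nfCoeff n y 1) •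
      (a • nfE n (n-2) + b • nfE n (n-1) + c • nfE n n)
  + (nfCoeff n x 1 * nfCoeff n y 3 - nfCoeff n x 3 * nfCoeff n y 1) •
      (δ • (a • nfE n (n-1) + b • nfE n n))
  + (nfCoeff n x 2 * nfCoeff n y 3 - nfCoeff n x 3 * nfCoeff n y 2) •
      (((δ^2 - δ)/2 * a) • nfE n n)
  + (nfCoeff n x 1 * nfCoeff n y 4 - nfCoeff n x 4 * nfCoeff n y 1) •
      (((δ^2 + δ)/2 * a) • nfE n n)

/-- Two bracket structures on `μ₀ⁿ` are isomorphic (as transposed δ-Poisson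
algebras): there is a linear bijection preserving both `·` and `[-,-]`. -/
noncomputable def TPIso (n : ℕ) (B B' : (Fin n → ℂ) → (Fin n → ℂ) → (Fin n → ℂ)) : Prop :=
  ∃ φ : (Fin n → ℂ) ≃ₗ[ℂ] (Fin n → ℂ),
    (∀ x y, φ (nfMul n x y) = nfMul n (φ x) (φ y)) ∧
    ∀ x y, φ (B x y) = B' (φ x) (φ y)

theorem nfMul_E (n a b : ℕ) (ha : 1 ≤ a) (hb : 1 ≤ b) :
    nfMul n (nfE n a) (nfE n b) = nfE n (a + b) := by
  funext k
  have hk := k.2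
  unfold nfMul nfE
  by_cases h : (k : ℕ) + 1 = a + b
  · rw [if_pos h, Finset.sum_eq_single (⟨a - 1, by omega⟩ : Fin n),
      Finset.sum_eq_single (⟨b - 1, by omega⟩ : Fin n)]
    · have h1 : a - 1 + 1 = a := by omega
      have h2 : b - 1 + 1 = b := by omega
      have h3 : a - 1 + (b - 1) + 1 = (k : ℕ) := by omega
      simp [h1, h2, h3]
    · intro j _ hj
      have : ¬ ((j : ℕ) + 1 = b) := fun h' => hj (Fin.ext (by simp; omega))
      simp [this]
    · simp
    · intro j _ hj
      have : ¬ ((j : ℕ) + 1 = a) := fun h' => hj (Fin.ext (by simp; omega))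
      simp [this]
    · simp
  · rw [if_neg h]
    refine Finset.sum_eq_zero fun i _ => Finset.sum_eq_zero fun j _ => ?_
    split_ifs <;> first | omega | simp

/-- for `n ≥ 5`, any transposed `0`-Poisson structure on `μ₀ⁿ`
satisfies `[e₁,eᵢ] = 0` for `3 ≤ i ≤ n`. -/
theorem stmt_2 (n : ℕ) (hn : 5 ≤ n)
    (B : LieBracketOn (Fin n → ℂ)) (hB : IsTransposedPoisson n 0 B) :
    ∀ i, 3 ≤ i → i ≤ n → B.br (nfE n 1) (nfE n i) = 0 := by
  have key : ∀ i j k, 1 ≤ i → 1 ≤ j → 1 ≤ k →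
      B.br (nfE n (k + i)) (nfE n j) + B.br (nfE n i) (nfE n (k + j)) = 0 := by
    intro i j k hi hj hk
    have h := hB (nfE n i) (nfE n j) (nfE n k)
    rw [nfMul_E n k i hk hi, nfMul_E n k j hk hj, zero_smul] at h
    exact h.symm
  intro i hi _
  obtain ⟨m, rfl⟩ : ∃ m, i = 2 + m := ⟨i - 2, by omega⟩
  have h1 := key 1 m 2 le_rfl (by omega) (by omega)
  have h2 := key 1 (1 + m) 1 le_rfl (by omega) le_rfl
  have h3 := key 2 m 1 (by omega) (by omega) le_rfl
  rw [show 1 + (1 + m) = 2 + m by omega] at h2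
  norm_num at h1 h2 h3
  funext t
  have a1 := congrFun h1 t
  have a2 := congrFun h2 t
  have a3 := congrFun h3 t
  simp only [Pi.add_apply, Pi.zero_apply] at a1 a2 a3 ⊢
  linear_combination (1/2) * a1 + (1/2) * a2 - (1/2) * a3
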